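/- Let a, b ≥ 0 with n = a + b ≥ 1. Let P ∈ Z[X_1,…,X_n] be a polynomial in X_1,…,X_a that is symmetric in X_1,…,X_a, and let Q ∈ Z[X_1,…,X_n] be a polynomial in X_{a+1},…,X_n that is symmetric in X_{a+1},…,X_n. Let w = w[1,n]·w[1,a]·w[a+1,n] ∈ S_n (product in S_n of the longest element of S_n with the longest elements of S[1,a] and S[a+1,n]). Then ∂_w(PQ) is either zero or satisfies deg_*( ∂_w(PQ) ) ≤ max( deg_*(P) − b, deg_*(Q) − a ). -/

import Mathlib

open scoped BigOperators

namespace Dem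

/-- The polynomial ring `ℤ[X_1, …, X_n]` (0-based variables). -/
abbrev R (n : ℕ) := MvPolynomial (Fin n) ℤ

/-- `D` is the family of Demazure (BGG) operators `∂_i` (0-based), characterized
by `(X_{i+1} - X_i) · ∂_i P = P - s_i(P)`. -/
def IsDemFamily {n : ℕ} (D : ℕ → R n → R n) : Prop :=
  ∀ (i : ℕ) (h : i + 1 < n) (P : R n),
    (MvPolynomial.X (⟨i + 1, h⟩ : Fin n) - MvPolynomial.X ⟨i, by omega⟩) * D i P
      = P - MvPolynomial.rename (Equiv.swap (⟨i, by omega⟩ : Fin n) ⟨i + 1, h⟩) P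

/-- `∂_w = ∂_{i_1} ∘ ⋯ ∘ ∂_{i_r}` for a word `l = [i_1, …, i_r]` (rightmost
applied first). -/
def applyWord {n : ℕ} (D : ℕ → R n → R n) (l : List ℕ) (P : R n) : R n :=
  l.foldr (fun i Q => D i Q) P

/-- The permutation of `Fin n` given by a word in the simple transpositions. -/
def permOfWord (n : ℕ) (l : List ℕ) : Equiv.Perm (Fin n) :=
  (l.map fun i =>
    if h : i + 1 < n then Equiv.swap (⟨i, by omega⟩ : Fin n) ⟨i + 1, h⟩ else 1).prod

/-- `l` is a reduced word for the permutation `w`. -/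
def IsReducedWordFor (n : ℕ) (l : List ℕ) (w : Equiv.Perm (Fin n)) : Prop :=
  (∀ i ∈ l, i + 1 < n) ∧ permOfWord n l = w ∧
    ∀ l' : List ℕ, (∀ i ∈ l', i + 1 < n) → permOfWord n l' = w → l.length ≤ l'.length

/-- The standard reduced word for the longest element of `S_m` (0-based). -/
def longWord (m : ℕ) : List ℕ :=
  (List.range m).foldr (fun j acc => (List.range j).reverse ++ acc) []

/-- The set of variables `X_{lo+1}, …, X_n` (0-based indices `≥ lo`). -/
def varsFrom (n lo : ℕ) : Finset (Fin n) :=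
  Finset.univ.filter fun a : Fin n => lo ≤ a.val

/-- The set of variables `X_1, …, X_m` (0-based indices `< m`). -/
def varsUpto (n m : ℕ) : Finset (Fin n) :=
  Finset.univ.filter fun a : Fin n => a.val < m

/-- Elementary symmetric polynomial of degree `m` in the variables of `s`. -/
noncomputable def eOn {n : ℕ} (s : Finset (Fin n)) (m : ℕ) : R n :=
  ∑ T ∈ s.powersetCard m, ∏ a ∈ T, MvPolynomial.X a

/-- Complete homogeneous symmetric polynomial of degree `j` in the variables of
`s`. -/
noncomputable def hOn {n : ℕ} (s : Finset (Fin n)) (j : ℕ) : R n :=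
  ∑ d ∈ s.sym j, (Multiset.map MvPolynomial.X (d : Multiset (Fin n))).prod

/-- `P` is symmetric in the variables with (0-based) index `≥ lo`. -/
def SymFrom {n : ℕ} (lo : ℕ) (P : R n) : Prop :=
  ∀ a b : Fin n, lo ≤ a.val → lo ≤ b.val →
    MvPolynomial.rename (Equiv.swap a b) P = P

/-- The monomial symmetric polynomial in the first `c` of the `n` variables,
attached to the exponent vector `w` (the sum of the distinct monomials in the
`S_c`-orbit of `X_1^{w_1} ⋯ X_c^{w_c}`). -/
noncomputable def msymBlock {n : ℕ} (c : ℕ) (w : Fin c → ℕ) : R n :=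
  ∑ g ∈ Finset.image
      (fun σ : Equiv.Perm (Fin c) =>
        fun i : Fin n => if h : i.val < c then w (σ ⟨i.val, h⟩) else 0)
      Finset.univ,
    ∏ i, MvPolynomial.X i ^ g i

end Dem

namespace Dem

open MvPolynomial

section Operators

variable {n : ℕ}

/-- The simple transposition exchanging `i` and `i + 1`. -/
def simpleSwap {i : ℕ} (h : i + 1 < n) : Equiv.Perm (Fin n) :=
  Equiv.swap ⟨i, by omega⟩ ⟨i + 1, h⟩

lemma X_succ_sub_X_ne_zero {i : ℕ} (h : i + 1 < n) :
    (X (⟨i + 1, h⟩ : Fin n) - X ⟨i, by omega⟩ : R n) ≠ 0 := by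
  rw [sub_ne_zero]
  intro e
  have := X_injective e
  simp at this

lemma IsDemFamily.eq_of_mul_eq {D : ℕ → R n → R n} (hD : IsDemFamily D) {i : ℕ} (h : i + 1 < n)
    {P Q : R n}
    (e : (X (⟨i + 1, h⟩ : Fin n) - X ⟨i, by omega⟩) * Q = P - rename (simpleSwap h) P) :
    D i P = Q :=
  mul_left_cancel₀ (X_succ_sub_X_ne_zero h) ((hD i h P).trans e.symm)

lemma IsDemFamily.map_add {D : ℕ → R n → R n} (hD : IsDemFamily D) {i : ℕ} (h : i + 1 < n)
    (P Q : R n) : D i (P + Q) = D i P + D i Q := by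
  apply hD.eq_of_mul_eq h
  rw [mul_add, hD i h P, hD i h Q, _root_.map_add]
  simp only [simpleSwap]
  ring

lemma IsDemFamily.map_mul_of_invariant {D : ℕ → R n → R n} (hD : IsDemFamily D) {i : ℕ}
    (h : i + 1 < n) {F : R n} (hF : rename (simpleSwap h) F = F) (P : R n) :
    D i (F * P) = F * D i P := by
  apply hD.eq_of_mul_eq h
  rw [mul_left_comm, hD i h P, map_mul, hF]
  simp only [simpleSwap]
  ring

lemma IsDemFamily.map_mul_X {D : ℕ → R n → R n} (hD : IsDemFamily D) {i : ℕ}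
    (h : i + 1 < n) {F : R n} (hF : rename (simpleSwap h) F = F) :
    D i (F * X ⟨i, by omega⟩) = (-1) * F := by
  apply hD.eq_of_mul_eq h
  rw [map_mul, hF]
  simp only [simpleSwap, rename_X, Equiv.swap_apply_left]
  ring

lemma IsDemFamily.totalDegree_add_one_le {D : ℕ → R n → R n} (hD : IsDemFamily D) {i : ℕ}
    (h : i + 1 < n) {P : R n} (hP : D i P ≠ 0) :
    (D i P).totalDegree + 1 ≤ P.totalDegree := by
  have h1 : (X (⟨i + 1, h⟩ : Fin n) - X ⟨i, by omega⟩ : R n).totalDegree = 1 :=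
    ((isHomogeneous_X ℤ _).sub (isHomogeneous_X ℤ _)).totalDegree (X_succ_sub_X_ne_zero h)
  have h2 := totalDegree_mul_of_isDomain (X_succ_sub_X_ne_zero h) hP
  rw [hD i h P, h1] at h2
  have h3 := totalDegree_sub P (rename (simpleSwap h) P)
  have h4 := totalDegree_rename_le (simpleSwap h) P
  rw [max_eq_left h4] at h3
  simp only [simpleSwap] at h3
  omega

lemma applyWord_append (D : ℕ → R n → R n) (l v : List ℕ) (P : R n) :
    applyWord D (l ++ v) P = applyWord D l (applyWord D v P) := by
  simp [applyWord, List.foldr_append]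

lemma applyWord_cons (D : ℕ → R n → R n) (i : ℕ) (l : List ℕ) (P : R n) :
    applyWord D (i :: l) P = D i (applyWord D l P) := rfl

variable {D : ℕ → R n → R n} (hD : IsDemFamily D) {l : List ℕ}
include hD

lemma applyWord_add (hl : ∀ i ∈ l, i + 1 < n) (P Q : R n) :
    applyWord D l (P + Q) = applyWord D l P + applyWord D l Q := by
  induction l with
  | nil => rfl
  | cons i l ih =>
    simp only [List.forall_mem_cons] at hl
    simp only [applyWord_cons, ih hl.2, hD.map_add hl.1]

lemma applyWord_mul_of_invariant {F : R n}
    (hl : ∀ i ∈ l, ∃ h : i + 1 < n, rename (simpleSwap h) F = F) (P : R n) :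
    applyWord D l (F * P) = F * applyWord D l P := by
  induction l with
  | nil => rfl
  | cons i l ih =>
    simp only [List.forall_mem_cons] at hl
    obtain ⟨⟨h, hi⟩, hl⟩ := hl
    simp only [applyWord_cons, ih hl, hD.map_mul_of_invariant h hi]

lemma applyWord_mul_of_isSymmetric (hl : ∀ i ∈ l, i + 1 < n) {F : R n} (hF : F.IsSymmetric)
    (P : R n) : applyWord D l (F * P) = F * applyWord D l P :=
  applyWord_mul_of_invariant hD (fun i hi => ⟨hl i hi, hF _⟩) P

lemma totalDegree_applyWord_add_length_le (hl : ∀ i ∈ l, i + 1 < n) {P : R n}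
    (hP : applyWord D l P ≠ 0) :
    (applyWord D l P).totalDegree + l.length ≤ P.totalDegree := by
  induction l with
  | nil => simp [applyWord]
  | cons i l ih =>
    simp only [List.forall_mem_cons] at hl
    rw [applyWord_cons] at hP ⊢
    have h0 : applyWord D l P ≠ 0 := by
      intro h0
      have := hD i hl.1 0
      simp only [map_zero, sub_zero, mul_eq_zero, X_succ_sub_X_ne_zero hl.1, false_or] at this
      exact hP (by rw [h0, this])
    have := ih hl.2 h0
    have := hD.totalDegree_add_one_le hl.1 hP
    simp only [List.length_cons]
    omega

end Operators

section Monomials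

variable {n : ℕ}

/-- The monomial with exponent vector `e`. -/
noncomputable def powProd (e : Fin n → ℕ) : R n := ∏ i, X i ^ e i

lemma rename_powProd (σ : Equiv.Perm (Fin n)) (e : Fin n → ℕ) :
    rename σ (powProd e) = powProd (e ∘ σ.symm) := by
  simp only [powProd, map_prod, map_pow, rename_X]
  rw [← Equiv.prod_comp σ fun i => (X i : R n) ^ (e ∘ σ.symm) i]
  simp

lemma powProd_eq_monomial (e : Fin n → ℕ) :
    powProd e = monomial (Finsupp.equivFunOnFinite.symm e) 1 := by
  rw [monomial_eq, Finsupp.prod_fintype _ _ (by simp)]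
  simp [powProd]

lemma powProd_zero : powProd (0 : Fin n → ℕ) = 1 := by simp [powProd]

lemma powProd_add (e f : Fin n → ℕ) : powProd (e + f) = powProd e * powProd f := by
  simp [powProd, pow_add, Finset.prod_mul_distrib]

lemma powProd_single (i : Fin n) (k : ℕ) : powProd (Pi.single i k) = X i ^ k := by
  rw [powProd, Finset.prod_eq_single i] <;> simp +contextual

lemma totalDegree_powProd (e : Fin n → ℕ) : (powProd e).totalDegree = ∑ i, e i := by
  rw [powProd_eq_monomial, totalDegree_monomial _ one_ne_zero, Finsupp.sum_fintype _ _ (by simp)]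
  simp

lemma degreeOf_powProd (e : Fin n → ℕ) (i : Fin n) : degreeOf i (powProd e) = e i := by
  rw [powProd_eq_monomial, degreeOf_monomial_eq _ _ one_ne_zero]
  simp

/-- The staircase exponent vector `(n - 1, …, 1, 0)`. -/
def staircase (n : ℕ) (i : Fin n) : ℕ := n - 1 - i.val

lemma staircase_injective : Function.Injective (staircase n) := by
  intro i j h
  simp only [staircase] at h
  ext
  omega

lemma eq_staircase_of_injective {e : Fin n → ℕ} (he : ∀ i, e i ≤ staircase n i)
    (h : Function.Injective e) : e = staircase n := by
  have hlt : ∀ i, e i < n := fun i => by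
    have := he i
    have := i.isLt
    simp only [staircase] at *
    omega
  let f : Fin n → Fin n := fun i => ⟨e i, hlt i⟩
  have hf : Function.Bijective f := Finite.injective_iff_bijective.mp fun i j hij => h (by
    simpa [f] using hij)
  have h1 : ∑ i, e i = ∑ i : Fin n, i.val := hf.sum_comp (fun i : Fin n => i.val)
  have h2 : ∑ i, staircase n i = ∑ i : Fin n, i.val := by
    rw [← Equiv.sum_comp Fin.revPerm]
    refine Finset.sum_congr rfl fun i _ => ?_
    simp only [staircase, Fin.revPerm_apply, Fin.val_rev]
    omega
  have h3 := (Finset.sum_eq_sum_iff_of_le fun i _ => he i).mp (h1.trans h2.symm)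
  exact funext fun i => h3 i (Finset.mem_univ i)

/-- The antisymmetrization of `f`. -/
noncomputable def alternate (f : R n) : R n :=
  ∑ σ : Equiv.Perm (Fin n), (Equiv.Perm.sign σ : ℤ) • rename σ f

lemma alternate_add (f g : R n) : alternate (f + g) = alternate f + alternate g := by
  simp [alternate, Finset.sum_add_distrib]

lemma alternate_mul_of_isSymmetric {g : R n} (hg : g.IsSymmetric) (f : R n) :
    alternate (g * f) = g * alternate f := by
  simp only [alternate, Finset.mul_sum, map_mul, hg _, mul_smul_comm]

lemma alternate_eq_zero {f : R n} {i j : Fin n} (hij : i ≠ j)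
    (hf : rename (Equiv.swap i j) f = f) : alternate f = 0 := by
  have h : alternate f = -alternate f := by
    conv_lhs => rw [alternate, ← Equiv.sum_comp (Equiv.mulRight (Equiv.swap i j))]
    rw [alternate, ← Finset.sum_neg_distrib]
    refine Finset.sum_congr rfl fun σ _ => ?_
    rw [Equiv.coe_mulRight, Equiv.Perm.coe_mul, ← rename_rename, hf, Equiv.Perm.sign_mul,
      Equiv.Perm.sign_swap hij]
    simp
  exact self_eq_neg.mp h

lemma coeff_alternate_staircase_ne_zero (τ : Equiv.Perm (Fin n)) :
    coeff (Finsupp.equivFunOnFinite.symm (staircase n ∘ τ.symm))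
      (alternate (powProd (staircase n))) ≠ 0 := by
  rw [alternate, coeff_sum, Finset.sum_eq_single τ]
  · rw [rename_powProd, powProd_eq_monomial, coeff_smul, coeff_monomial, if_pos rfl]
    simp
  · intro σ _ hσ
    rw [rename_powProd, powProd_eq_monomial, coeff_smul, coeff_monomial, if_neg, smul_zero]
    intro h
    apply hσ
    have h' := staircase_injective.comp_left (Finsupp.equivFunOnFinite.symm.injective h)
    exact Equiv.symm_bijective.injective (Equiv.ext (congrFun h'))
  · simp

lemma alternate_staircase_ne_zero (n : ℕ) : alternate (powProd (staircase n)) ≠ 0 :=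
  ne_zero_iff.mpr ⟨_, coeff_alternate_staircase_ne_zero 1⟩

lemma le_degreeOf_alternate_staircase (k : Fin n) :
    n - 1 ≤ degreeOf k (alternate (powProd (staircase n))) := by
  have := monomial_le_degreeOf k
    (mem_support_iff.mpr (coeff_alternate_staircase_ne_zero (Equiv.swap ⟨0, k.pos⟩ k)))
  simpa [staircase] using this

lemma degreeOf_alternate_le {f : R n} {d : ℕ} (hf : ∀ j, degreeOf j f ≤ d) (k : Fin n) :
    degreeOf k (alternate f) ≤ d := by
  refine (degreeOf_sum_le _ _ _).trans (Finset.sup_le fun σ _ => ?_)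
  rw [zsmul_eq_mul, ← map_intCast (C : ℤ →+* R n)]
  refine (degreeOf_C_mul_le _ _ _).trans ?_
  have := degreeOf_rename_of_injective (p := f) σ.injective (σ.symm k)
  rw [Equiv.apply_symm_apply] at this
  rw [this]
  exact hf _

lemma rename_swap_of_degreeOf_eq_zero {F : R n} {u v : Fin n} (hu : degreeOf u F = 0)
    (hv : degreeOf v F = 0) : rename (Equiv.swap u v) F = F := by
  have hvars : ∀ {w : Fin n}, degreeOf w F = 0 → w ∉ F.vars := by
    intro w hw
    rwa [vars_def, Multiset.mem_toFinset, ← Multiset.count_eq_zero, ← degreeOf_def]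
  refine hom_congr_vars (f₁ := (rename (Equiv.swap u v) : R n →ₐ[ℤ] R n).toRingHom)
    (f₂ := RingHom.id _) (RingHom.ext_int _ _) (fun i hi _ => ?_) rfl
  have h1 : i ≠ u := fun h => hvars hu (h ▸ hi)
  have h2 : i ≠ v := fun h => hvars hv (h ▸ hi)
  simp [Equiv.swap_apply_of_ne_of_ne h1 h2]

end Monomials

section Spanning

/-- The subring generated by the symmetric polynomials and the first `k` variables. -/
noncomputable def symAdjoin (n k : ℕ) : Subalgebra ℤ (R n) :=
  Algebra.adjoin ℤ ({f | f.IsSymmetric} ∪ {f | ∃ i : Fin n, i.val < k ∧ f = X i})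

variable {n : ℕ}

lemma symAdjoin_mono {k m : ℕ} (h : k ≤ m) : symAdjoin n k ≤ symAdjoin n m :=
  Algebra.adjoin_mono (Set.union_subset_union_right _ fun _ ⟨i, hi, e⟩ => ⟨i, hi.trans_le h, e⟩)

lemma X_mem_symAdjoin {k : ℕ} (i : Fin n) (h : i.val < k) : (X i : R n) ∈ symAdjoin n k :=
  Algebra.subset_adjoin (Or.inr ⟨i, h, rfl⟩)

lemma isSymmetric_of_mem_symAdjoin_zero {f : R n} (hf : f ∈ symAdjoin n 0) : f.IsSymmetric := by
  have : symAdjoin n 0 ≤ symmetricSubalgebra (Fin n) ℤ :=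
    Algebra.adjoin_le (by rintro f (hf | ⟨i, hi, -⟩); exacts [hf, absurd hi (by omega)])
  exact this hf

lemma exists_monic_map_eq_prod (n k : ℕ) (hk : k ≤ n) :
    ∃ p : Polynomial (symAdjoin n k), p.Monic ∧ p.map (algebraMap (symAdjoin n k) (R n)) =
      ∏ j : Fin n with k ≤ j.val, (Polynomial.X - Polynomial.C (X j)) := by
  induction k with
  | zero =>
    have hmon : (∏ j with 0 ≤ Fin.val j,
        (Polynomial.X - Polynomial.C (X j : R n))).Monic :=
      Polynomial.monic_prod_of_monic _ _ fun j _ => Polynomial.monic_X_sub_C _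
    have hl : (∏ j with 0 ≤ Fin.val j, (Polynomial.X - Polynomial.C (X j : R n))) ∈
        Polynomial.lifts (algebraMap (symAdjoin n 0) (R n)) := by
      rw [Polynomial.lifts_iff_coeff_lifts]
      intro m
      refine ⟨⟨_, Algebra.subset_adjoin (Or.inl fun σ => ?_)⟩, rfl⟩
      have := Polynomial.coeff_map (p := ∏ j with 0 ≤ Fin.val j,
        (Polynomial.X - Polynomial.C (X j : R n))) (rename σ : R n →ₐ[ℤ] R n).toRingHom m
      refine Eq.trans this.symm ?_
      congr 1
      simp only [Polynomial.map_prod, Polynomial.map_sub, Polynomial.map_X, Polynomial.map_C,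
        zero_le, Finset.filter_true]
      refine Eq.trans (Finset.prod_congr rfl fun j _ => ?_)
        (Equiv.prod_comp σ fun j => (Polynomial.X - Polynomial.C (X j : R n)))
      congr 2
      exact rename_X _ _
    obtain ⟨q, hq, -, hqm⟩ := Polynomial.lifts_and_degree_eq_and_monic hl hmon
    exact ⟨q, hqm, hq⟩
  | succ k ih =>
    obtain ⟨p, hp, he⟩ := ih (by omega)
    let ι : symAdjoin n k →ₐ[ℤ] symAdjoin n (k + 1) :=
      Subalgebra.inclusion (symAdjoin_mono (Nat.le_succ k))
    let x : symAdjoin n (k + 1) := ⟨X ⟨k, hk⟩, X_mem_symAdjoin _ (Nat.lt_succ_self k)⟩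
    have hmap : (p.map ι.toRingHom /ₘ (Polynomial.X - Polynomial.C x)).map
        (algebraMap (symAdjoin n (k + 1)) (R n)) =
        ∏ j : Fin n with k + 1 ≤ j.val, (Polynomial.X - Polynomial.C (X j)) := by
      rw [Polynomial.map_divByMonic _ (Polynomial.monic_X_sub_C x), Polynomial.map_map]
      have h1 : (algebraMap (symAdjoin n (k + 1)) (R n)).comp ι.toRingHom =
        algebraMap (symAdjoin n k) (R n) := rfl
      have h2 : ({j : Fin n | k ≤ j.val} : Finset (Fin n)) =
          insert ⟨k, hk⟩ ({j : Fin n | k + 1 ≤ j.val} : Finset (Fin n)) := by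
        ext j
        simp only [Finset.mem_filter, Finset.mem_univ, true_and, Finset.mem_insert, Fin.ext_iff]
        omega
      rw [h1, he, h2, Finset.prod_insert (by simp), Polynomial.map_sub, Polynomial.map_X,
        Polynomial.map_C]
      exact Polynomial.mul_divByMonic_cancel_left _ (Polynomial.monic_X_sub_C _)
    refine ⟨_, ?_, hmap⟩
    have hinj : Function.Injective (algebraMap (symAdjoin n (k + 1)) (R n)) :=
      Subtype.val_injective
    refine Polynomial.monic_of_injective hinj ?_
    rw [hmap]
    exact Polynomial.monic_prod_of_monic _ _ fun j _ => Polynomial.monic_X_sub_C _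

lemma exists_aeval_eq_of_mem_symAdjoin_succ {k : ℕ} (hk : k < n) {f : R n}
    (hf : f ∈ symAdjoin n (k + 1)) :
    ∃ r : Polynomial (symAdjoin n k), Polynomial.aeval (X ⟨k, hk⟩ : R n) r = f := by
  refine Algebra.adjoin_induction
    (p := fun f _ => ∃ r : Polynomial (symAdjoin n k), Polynomial.aeval (X ⟨k, hk⟩ : R n) r = f)
    ?_ ?_ ?_ ?_ hf
  · rintro f (hf | ⟨i, hi, rfl⟩)
    · exact ⟨Polynomial.C ⟨f, Algebra.subset_adjoin (Or.inl hf)⟩, by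
        rw [Polynomial.aeval_C]; rfl⟩
    · obtain hi | hi := Nat.lt_succ_iff_lt_or_eq.mp hi
      · exact ⟨Polynomial.C ⟨X i, X_mem_symAdjoin i hi⟩, by rw [Polynomial.aeval_C]; rfl⟩
      · refine ⟨Polynomial.X, ?_⟩
        rw [Polynomial.aeval_X]
        congr 1
        ext
        exact hi.symm
  · exact fun m => ⟨Polynomial.C (algebraMap ℤ _ m), by rw [Polynomial.aeval_C]; rfl⟩
  · rintro f g - - ⟨r, rfl⟩ ⟨s, rfl⟩
    exact ⟨r + s, map_add _ _ _⟩
  · rintro f g - - ⟨r, rfl⟩ ⟨s, rfl⟩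
    exact ⟨r * s, map_mul _ _ _⟩

lemma exists_eq_sum_of_mem_symAdjoin_succ {k : ℕ} (hk : k < n) {f : R n}
    (hf : f ∈ symAdjoin n (k + 1)) :
    ∃ c : ℕ → R n, (∀ j, c j ∈ symAdjoin n k) ∧
      f = ∑ j ∈ Finset.range (n - k), c j * X ⟨k, hk⟩ ^ j := by
  obtain ⟨r, hr⟩ := exists_aeval_eq_of_mem_symAdjoin_succ hk hf
  obtain ⟨p, hp, he⟩ := exists_monic_map_eq_prod n k hk.le
  have hcard : (({j : Fin n | k ≤ j.val} : Finset (Fin n))).card = n - k := by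
    rw [← Fin.card_Ici ⟨k, hk⟩]
    congr 1
    ext j
    simp [Fin.le_def]
  have hdeg : p.natDegree = n - k := by
    rw [← hp.natDegree_map (algebraMap (symAdjoin n k) (R n)), he,
      Polynomial.natDegree_prod_of_monic _ _ fun j _ => Polynomial.monic_X_sub_C _]
    simp [hcard]
  have hroot : Polynomial.aeval (X ⟨k, hk⟩ : R n) p = 0 := by
    rw [Polynomial.aeval_def, ← Polynomial.eval_map, he, Polynomial.eval_prod]
    exact Finset.prod_eq_zero (i := ⟨k, hk⟩) (by simp) (by simp)
  refine ⟨fun j => ((r %ₘ p).coeff j : R n), fun j => ((r %ₘ p).coeff j).2, ?_⟩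
  rw [← hr, ← Polynomial.aeval_modByMonic_eq_self_of_root hroot,
    Polynomial.aeval_eq_sum_range' (n := n - k)]
  · rfl
  · have := Polynomial.natDegree_modByMonic_lt r hp (by
      rintro rfl
      simp at hdeg
      omega)
    omega

end Spanning

section LongWords

variable {n : ℕ} {D : ℕ → R n → R n} (hD : IsDemFamily D) {l : List ℕ}
include hD

lemma applyWord_powProd_mul_alternate (hl : ∀ i ∈ l, i + 1 < n)
    (hlen : ∑ i, staircase n i ≤ l.length) {e : Fin n → ℕ} (he : ∀ i, e i ≤ staircase n i) :
    applyWord D l (powProd e) * alternate (powProd (staircase n)) =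
      applyWord D l (powProd (staircase n)) * alternate (powProd e) := by
  by_cases h : Function.Injective e
  · rw [eq_staircase_of_injective he h]
  · have hlt : ∑ i, e i < ∑ i, staircase n i := by
      refine lt_of_le_of_ne (Finset.sum_le_sum fun i _ => he i) fun hs => h ?_
      have := (Finset.sum_eq_sum_iff_of_le fun i _ => he i).mp hs
      rw [show e = staircase n from funext fun i => this i (Finset.mem_univ i)]
      exact staircase_injective
    have h0 : applyWord D l (powProd e) = 0 := by
      by_contra hne
      have := totalDegree_applyWord_add_length_le hD hl hne
      rw [totalDegree_powProd] at this
      omega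
    simp only [Function.Injective, not_forall] at h
    obtain ⟨i, j, hij, hne⟩ := h
    suffices hf : rename (Equiv.swap i j) (powProd e) = powProd e by
      rw [h0, alternate_eq_zero hne hf, zero_mul, mul_zero]
    rw [rename_powProd, Equiv.symm_swap]
    congr 1
    funext k
    simp only [Function.comp_apply, Equiv.swap_apply_def]
    split_ifs with h1 h2
    · rw [h1, hij]
    · rw [h2, hij]
    · rfl

lemma applyWord_mul_alternate_of_mem_symAdjoin (hl : ∀ i ∈ l, i + 1 < n)
    (hlen : ∑ i, staircase n i ≤ l.length) {k : ℕ} (hk : k ≤ n) :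
    ∀ f ∈ symAdjoin n k, ∀ e : Fin n → ℕ, (∀ i, e i ≤ staircase n i) →
      (∀ i, i.val < k → e i = 0) →
      applyWord D l (f * powProd e) * alternate (powProd (staircase n)) =
        applyWord D l (powProd (staircase n)) * alternate (f * powProd e) := by
  induction k with
  | zero =>
    intro f hf e he _
    have hs := isSymmetric_of_mem_symAdjoin_zero hf
    rw [applyWord_mul_of_isSymmetric hD hl hs, alternate_mul_of_isSymmetric hs, mul_assoc,
      applyWord_powProd_mul_alternate hD hl hlen he, mul_left_comm]
  | succ k ih =>
    intro f hf e he hz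
    obtain ⟨c, hc, rfl⟩ := exists_eq_sum_of_mem_symAdjoin_succ hk hf
    rw [Finset.sum_mul]
    suffices H : ∀ s : Finset ℕ, (∀ j ∈ s, j < n - k) →
        applyWord D l (∑ j ∈ s, c j * X ⟨k, hk⟩ ^ j * powProd e) *
          alternate (powProd (staircase n)) =
        applyWord D l (powProd (staircase n)) *
          alternate (∑ j ∈ s, c j * X ⟨k, hk⟩ ^ j * powProd e) from
      H _ fun j hj => Finset.mem_range.mp hj
    intro s hs
    induction s using Finset.induction_on with
    | empty =>
      have := applyWord_add hD hl 0 0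
      rw [add_zero, left_eq_add] at this
      simp [this, alternate]
    | insert j s hj ihs =>
      rw [Finset.sum_insert hj, applyWord_add hD hl, alternate_add, add_mul, mul_add,
        ihs fun i hi => hs i (Finset.mem_insert_of_mem hi)]
      congr 1
      rw [mul_assoc, ← powProd_single, ← powProd_add]
      refine ih (by omega) _ (hc j) _ (fun i => ?_) fun i hi => ?_
      · have hj := hs j (Finset.mem_insert_self _ _)
        by_cases hik : i = ⟨k, hk⟩
        · subst hik
          simp only [Pi.add_apply, Pi.single_eq_same, hz ⟨k, hk⟩ (Nat.lt_succ_self k),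
            staircase]
          omega
        · simpa [hik] using he i
      · have hik : i ≠ ⟨k, hk⟩ := by
          rintro rfl
          exact absurd hi (lt_irrefl _)
        simpa [hik] using hz i (by omega)

theorem exists_applyWord_mul_alternate (hl : ∀ i ∈ l, i + 1 < n)
    (hlen : ∑ i, staircase n i ≤ l.length) :
    ∃ c : ℤ, ∀ f : R n, applyWord D l f * alternate (powProd (staircase n)) =
      C c * alternate f := by
  have hdeg : (applyWord D l (powProd (staircase n))).totalDegree = 0 := by
    by_cases h : applyWord D l (powProd (staircase n)) = 0
    · simp [h]
    · have := totalDegree_applyWord_add_length_le hD hl h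
      rw [totalDegree_powProd] at this
      omega
  refine ⟨coeff 0 (applyWord D l (powProd (staircase n))), fun f => ?_⟩
  rw [← totalDegree_eq_zero_iff_eq_C.mp hdeg]
  have hf : f ∈ symAdjoin n n := by
    induction f using MvPolynomial.induction_on with
    | C a => exact (symAdjoin n n).algebraMap_mem a
    | add p q hp hq => exact add_mem hp hq
    | mul_X p i hp => exact mul_mem hp (X_mem_symAdjoin i i.isLt)
  simpa [powProd_zero] using applyWord_mul_alternate_of_mem_symAdjoin hD hl hlen le_rfl f hf 0
    (fun i => Nat.zero_le _) fun _ _ => rfl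

lemma degreeOf_applyWord_add_le (hl : ∀ i ∈ l, i + 1 < n)
    (hlen : ∑ i, staircase n i ≤ l.length) {f : R n} {d : ℕ} (hf : ∀ j, degreeOf j f ≤ d)
    (h0 : applyWord D l f ≠ 0) (k : Fin n) :
    degreeOf k (applyWord D l f) + (n - 1) ≤ d := by
  obtain ⟨c, hc⟩ := exists_applyWord_mul_alternate hD hl hlen
  have h1 := degreeOf_mul_eq (n := k) h0 (alternate_staircase_ne_zero n)
  rw [hc f] at h1
  have h2 := (degreeOf_C_mul_le (alternate f) k c).trans (degreeOf_alternate_le hf k)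
  have h3 := le_degreeOf_alternate_staircase k
  omega

end LongWords

section Parabolic

variable {n : ℕ}

/-- Some word of length `∑ i, e i` avoiding the letter exchanging `a - 1` and `a` sends
`F * powProd e` to `± F` for every `F` symmetric in both blocks of variables. -/
def Collapses (D : ℕ → R n → R n) (a : ℕ) (e : Fin n → ℕ) : Prop :=
  ∃ v : List ℕ, (∀ i ∈ v, i + 1 < n) ∧ v.length = ∑ i, e i ∧
    ∀ F : R n, (∀ (i : ℕ) (h : i + 1 < n), i + 1 ≠ a → rename (simpleSwap h) F = F) →
      applyWord D v (F * powProd e) = F ∨ applyWord D v (F * powProd e) = (-1) * F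

variable {D : ℕ → R n → R n} (hD : IsDemFamily D)

lemma collapses_zero (a : ℕ) : Collapses D a 0 :=
  ⟨[], by simp, by simp, fun F _ => Or.inl (by simp [powProd_zero, applyWord])⟩

include hD in
lemma Collapses.add_single {a : ℕ} {e : Fin n → ℕ} (he : Collapses D a e) {i : ℕ}
    (h : i + 1 < n) (hi : i + 1 ≠ a) (heq : e ⟨i, by omega⟩ = e ⟨i + 1, h⟩) :
    Collapses D a (e + Pi.single ⟨i, by omega⟩ 1) := by
  obtain ⟨v, hv, hlen, H⟩ := he
  refine ⟨v ++ [i], ?_, ?_, fun F hF => ?_⟩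
  · simp only [List.mem_append, List.mem_singleton]
    rintro j (hj | rfl)
    exacts [hv j hj, h]
  · simp [hlen, Finset.sum_add_distrib]
  · have hsym : rename (simpleSwap h) (F * powProd e) = F * powProd e := by
      rw [map_mul, hF i h hi, rename_powProd]
      congr 2
      funext k
      simp only [simpleSwap, Equiv.symm_swap, Function.comp_apply, Equiv.swap_apply_def]
      split_ifs with h1 h2
      · rw [h1, heq]
      · rw [h2, heq]
      · rfl
    have hstep : applyWord D [i] (F * powProd (e + Pi.single ⟨i, by omega⟩ 1)) =
        (-1) * (F * powProd e) := by
      rw [powProd_add, powProd_single, pow_one, ← mul_assoc]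
      exact hD.map_mul_X h hsym
    have hneg : applyWord D v ((-1) * (F * powProd e)) = (-1) * applyWord D v (F * powProd e) :=
      applyWord_mul_of_isSymmetric hD hv (F := -1) (fun σ => by simp) _
    rw [applyWord_append, hstep, hneg]
    rcases H F hF with h' | h' <;> rw [h']
    · exact Or.inr rfl
    · exact Or.inl (by ring)

/-- The staircase `(m - 1, …, 1, 0)` placed on the `m` variables starting at `lo`. -/
def blockStaircase (n lo m : ℕ) (i : Fin n) : ℕ :=
  if lo ≤ i.val then lo + m - 1 - i.val else 0

/-- The staircase on `k` variables starting at `lo`, raised by one on the variables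
`lo + j, …, lo + k - 1`. -/
def partialStaircase (n lo k j : ℕ) (i : Fin n) : ℕ :=
  if lo ≤ i.val then (if i.val < lo + j then lo + k - 1 - i.val else lo + k - i.val) else 0

include hD in
lemma Collapses.add_blockStaircase {a lo : ℕ} {e : Fin n → ℕ} (he : Collapses D a e) (m : ℕ)
    (hm : lo + m ≤ n) (hz : ∀ i : Fin n, lo ≤ i.val → i.val < lo + m → e i = 0)
    (ha : ∀ i, lo ≤ i → i + 1 < lo + m → i + 1 ≠ a) :
    Collapses D a (e + blockStaircase n lo m) := by
  induction m with
  | zero =>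
    convert he using 1
    funext i
    simp only [Pi.add_apply, blockStaircase]
    split_ifs <;> omega
  | succ m ih =>
    have key : ∀ d, d ≤ m → Collapses D a (e + partialStaircase n lo m (m - d)) := by
      intro d
      induction d with
      | zero =>
        intro _
        convert ih (by omega) (fun i h1 h2 => hz i h1 (by omega))
          (fun i h1 h2 => ha i h1 (by omega)) using 2
        funext i
        simp only [partialStaircase, blockStaircase]
        split_ifs <;> omega
      | succ d ihd =>
        intro hd
        have hlt : lo + (m - (d + 1)) + 1 < n := by omega
        have := (ihd (by omega)).add_single hD hlt (ha _ (by omega) (by omega)) (by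
          simp only [Pi.add_apply]
          rw [hz _ (by simp) (by simp only; omega), hz _ (by simp only; omega) (by simp only; omega)]
          simp only [partialStaircase]
          split_ifs <;> omega)
        convert this using 1
        rw [add_assoc]
        congr 1
        funext i
        simp only [partialStaircase, Pi.add_apply, Pi.single_apply, Fin.ext_iff]
        split_ifs <;> omega
    convert key m le_rfl using 2
    funext i
    simp only [partialStaircase, blockStaircase]
    split_ifs <;> omega

/-- The two-block staircase `(a - 1, …, 0, n - a - 1, …, 0)`. -/
def twoBlockStaircase (n a : ℕ) (i : Fin n) : ℕ :=
  if i.val < a then a - 1 - i.val else n - 1 - i.val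

include hD in
lemma collapses_twoBlockStaircase {a : ℕ} (ha : a ≤ n) :
    Collapses D a (twoBlockStaircase n a) := by
  have h1 := (collapses_zero (D := D) a).add_blockStaircase hD (lo := a) (n - a) (by omega)
    (fun _ _ _ => rfl) (fun i hi _ => by omega)
  have h2 := h1.add_blockStaircase hD (lo := 0) a (by omega) ?_ (fun i _ hi => by omega)
  · convert h2 using 1
    funext i
    simp only [twoBlockStaircase, blockStaircase, Pi.add_apply, Pi.zero_apply]
    split_ifs <;> omega
  · intro i _ hi
    simp only [blockStaircase, Pi.add_apply, Pi.zero_apply]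
    split_ifs <;> omega

lemma sum_staircase_eq {a b : ℕ} (hn : n = a + b) :
    ∑ i, staircase n i = a * b + ∑ i, twoBlockStaircase n a i := by
  have h1 : ∀ i : Fin n,
      staircase n i = (if i.val < a then b else 0) + twoBlockStaircase n a i := by
    intro i
    simp only [staircase, twoBlockStaircase]
    split_ifs <;> omega
  rw [Finset.sum_congr rfl fun i _ => h1 i, Finset.sum_add_distrib, Finset.sum_ite,
    Finset.sum_const, Finset.sum_const_zero, add_zero, smul_eq_mul, Fin.card_filter_val_lt,
    min_eq_right (by omega)]

end Parabolic

section Length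

variable {n : ℕ}

lemma permOfWord_cons (i : ℕ) (l : List ℕ) :
    permOfWord n (i :: l) = (if h : i + 1 < n then simpleSwap h else 1) * permOfWord n l := rfl

lemma permOfWord_append (l v : List ℕ) :
    permOfWord n (l ++ v) = permOfWord n l * permOfWord n v := by
  simp [permOfWord]

lemma val_simpleSwap {i : ℕ} (h : i + 1 < n) (x : Fin n) :
    (simpleSwap h x).val = if x.val = i then i + 1 else if x.val = i + 1 then i else x.val := by
  simp only [simpleSwap, Equiv.swap_apply_def, Fin.ext_iff]
  split_ifs <;> rfl

lemma sum_permOfWord_le (l : List ℕ) (s : Finset (Fin n)) :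
    ∑ t ∈ s, (permOfWord n l t).val ≤ ∑ t ∈ s, t.val + l.length := by
  induction l with
  | nil => simp [permOfWord]
  | cons i l ih =>
    rw [permOfWord_cons, List.length_cons]
    split_ifs with h
    · have h1 : ∀ t ∈ s, ((simpleSwap h * permOfWord n l) t).val ≤
          (permOfWord n l t).val + if permOfWord n l t = ⟨i, by omega⟩ then 1 else 0 := by
        intro t _
        rw [Equiv.Perm.mul_apply, val_simpleSwap]
        simp only [Fin.ext_iff]
        split_ifs <;> omega
      have h2 : ∑ t ∈ s, (if permOfWord n l t = ⟨i, by omega⟩ then 1 else 0) ≤ 1 := by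
        rw [Finset.sum_boole, Nat.cast_id, Finset.card_le_one]
        intro x hx y hy
        simp only [Finset.mem_filter] at hx hy
        exact (permOfWord n l).injective (hx.2.trans hy.2.symm)
      have := Finset.sum_le_sum h1
      rw [Finset.sum_add_distrib] at this
      omega
    · rw [one_mul]
      omega

lemma permOfWord_lt_iff {a : ℕ} {l : List ℕ} (hl : ∀ i ∈ l, i + 1 ≠ a) (x : Fin n) :
    (permOfWord n l x).val < a ↔ x.val < a := by
  induction l with
  | nil => simp [permOfWord]
  | cons i l ih =>
    simp only [List.forall_mem_cons] at hl
    rw [permOfWord_cons, ← ih hl.2, Equiv.Perm.mul_apply]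
    split_ifs with h
    · have := hl.1
      rw [val_simpleSwap]
      split_ifs <;> omega
    · rfl

lemma longWord_succ (m : ℕ) : longWord (m + 1) = longWord m ++ (List.range m).reverse := by
  have key : ∀ (L : List ℕ) (acc : List ℕ),
      L.foldr (fun j acc => (List.range j).reverse ++ acc) acc =
        L.foldr (fun j acc => (List.range j).reverse ++ acc) [] ++ acc := by
    intro L acc
    induction L with
    | nil => rfl
    | cons j L ih => simp only [List.foldr_cons, ih, List.append_assoc]
  rw [longWord, List.range_succ, List.foldr_append, key]
  simp [longWord]

lemma mem_longWord {m i : ℕ} (h : i ∈ longWord m) : i + 1 < m := by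
  induction m with
  | zero => simp [longWord] at h
  | succ m ih =>
    rw [longWord_succ, List.mem_append] at h
    rcases h with h | h
    · have := ih h
      omega
    · simp only [List.mem_reverse, List.mem_range] at h
      omega

lemma permOfWord_range_reverse {m : ℕ} (hm : m < n) (x : Fin n) :
    (permOfWord n (List.range m).reverse x).val =
      if x.val = 0 then m else if x.val ≤ m then x.val - 1 else x.val := by
  induction m with
  | zero =>
    simp only [List.range_zero, List.reverse_nil, permOfWord, List.map_nil, List.prod_nil,
      Equiv.Perm.one_apply]
    split_ifs <;> omega
  | succ m ih =>
    rw [List.range_succ, List.reverse_append, List.reverse_singleton, List.singleton_append,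
      permOfWord_cons, dif_pos hm, Equiv.Perm.mul_apply, val_simpleSwap, ih (by omega)]
    split_ifs <;> omega

lemma permOfWord_longWord {m : ℕ} (hm : m ≤ n) (x : Fin n) :
    (permOfWord n (longWord m) x).val = if x.val < m then m - 1 - x.val else x.val := by
  induction m generalizing x with
  | zero => simp [longWord, permOfWord]
  | succ m ih =>
    rw [longWord_succ, permOfWord_append, Equiv.Perm.mul_apply, ih (by omega),
      permOfWord_range_reverse hm]
    split_ifs <;> omega

lemma mul_le_length_of_permOfWord_eq {a b : ℕ} (hn : n = a + b) {l : List ℕ}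
    (hl : permOfWord n l = permOfWord n (longWord n) * permOfWord n (longWord a) *
      permOfWord n ((longWord b).map (· + a))) :
    a * b ≤ l.length := by
  set s : Finset (Fin n) := {t | t.val < a} with hs
  set τ := permOfWord n (longWord a) * permOfWord n ((longWord b).map (· + a)) with hτ
  have hmem : ∀ x, τ x ∈ s ↔ x ∈ s := by
    intro x
    simp only [hs, Finset.mem_filter, Finset.mem_univ, true_and, hτ, Equiv.Perm.mul_apply]
    rw [permOfWord_lt_iff, permOfWord_lt_iff]
    · simp only [List.mem_map]
      rintro i ⟨j, -, rfl⟩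
      omega
    · intro i hi
      have := mem_longWord hi
      omega
  have h1 := sum_permOfWord_le l s
  have h2 : ∑ t ∈ s, (permOfWord n l t).val = ∑ t ∈ s, (n - 1 - t.val) := by
    refine Finset.sum_equiv τ (fun x => (hmem x).symm) fun x _ => ?_
    rw [hl, mul_assoc, ← hτ, Equiv.Perm.mul_apply, permOfWord_longWord le_rfl, if_pos (τ x).isLt]
  have h3 : ∀ f : ℕ → ℕ, ∑ t ∈ s, f t.val = ∑ t ∈ Finset.range a, f t := by
    intro f
    refine Finset.sum_bij (fun t _ => t.val) ?_ ?_ ?_ fun _ _ => rfl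
    · simp [hs]
    · intro x _ y _ h
      exact Fin.ext h
    · intro t ht
      have := Finset.mem_range.mp ht
      exact ⟨⟨t, by omega⟩, by simpa [hs] using this, rfl⟩
  have h4 : ∑ t ∈ Finset.range a, (n - 1 - t) = a * b + ∑ t ∈ Finset.range a, t := by
    rw [← smul_eq_mul, ← Finset.card_range a, ← Finset.sum_const, Finset.card_range,
      ← Finset.sum_add_distrib, ← Finset.sum_range_reflect (fun t => b + t)]
    refine Finset.sum_congr rfl fun t ht => ?_
    have := Finset.mem_range.mp ht
    omega
  rw [h2, h3 fun t => n - 1 - t, h3 fun t => t, h4] at h1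
  omega

end Length

end Dem
open Dem in
/-- For `P` a symmetric polynomial in `X_1,…,X_a` and `Q` a
symmetric polynomial in `X_{a+1},…,X_n` (`n = a + b`), and
`w = w[1,n]·w[1,a]·w[a+1,n]`, the polynomial `∂_w(PQ)` is zero or satisfies
`deg_*(∂_w(PQ)) ≤ max(deg_*(P) - b, deg_*(Q) - a)`. -/
theorem statement11 (a b n : ℕ) (hn : n = a + b) (hn1 : 1 ≤ n)
    (P Q : R n)
    (hPvars : ∀ j : Fin n, a ≤ j.val → MvPolynomial.degreeOf j P = 0)
    (hPsym : ∀ u v : Fin n, u.val < a → v.val < a →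
      MvPolynomial.rename (Equiv.swap u v) P = P)
    (hQvars : ∀ j : Fin n, j.val < a → MvPolynomial.degreeOf j Q = 0)
    (hQsym : ∀ u v : Fin n, a ≤ u.val → a ≤ v.val →
      MvPolynomial.rename (Equiv.swap u v) Q = Q)
    (D : ℕ → R n → R n) (hD : IsDemFamily D)
    (l : List ℕ)
    (hl : IsReducedWordFor n l
      (permOfWord n (longWord n) * permOfWord n (longWord a) *
        permOfWord n ((longWord b).map (· + a)))) :
    applyWord D l (P * Q) = 0 ∨
      ∀ idx : Fin n,
        (MvPolynomial.degreeOf idx (applyWord D l (P * Q)) : ℤ)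
          ≤ max (((Finset.univ.sup fun j => MvPolynomial.degreeOf j P : ℕ) : ℤ) - b)
              (((Finset.univ.sup fun j => MvPolynomial.degreeOf j Q : ℕ) : ℤ) - a) := by
  subst hn
  have hlen := mul_le_length_of_permOfWord_eq rfl hl.2.1
  obtain ⟨v, hv, hvlen, H⟩ := collapses_twoBlockStaircase (n := a + b) hD (Nat.le_add_right a b)
  have hPQ : ∀ (i : ℕ) (h : i + 1 < a + b), i + 1 ≠ a →
      MvPolynomial.rename (simpleSwap h) (P * Q) = P * Q := by
    intro i h hi
    rw [map_mul]
    rcases lt_or_ge (i + 1) a with hlt | hge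
    · rw [simpleSwap, hPsym _ _ (by simp only; omega) hlt,
        rename_swap_of_degreeOf_eq_zero (hQvars _ (by simp only; omega)) (hQvars _ hlt)]
    · rw [simpleSwap, hQsym _ _ (by simp only; omega) hge,
        rename_swap_of_degreeOf_eq_zero (hPvars _ (by simp only; omega)) (hPvars _ hge)]
  have hw : ∀ i ∈ l ++ v, i + 1 < a + b := by
    intro i hi
    exact (List.mem_append.mp hi).elim (hl.1 i) (hv i)
  have hwlen : ∑ i, staircase (a + b) i ≤ (l ++ v).length := by
    rw [sum_staircase_eq rfl, List.length_append, hvlen]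
    omega
  have hw0 : applyWord D (l ++ v) (P * Q * powProd (twoBlockStaircase (a + b) a)) =
        applyWord D l (P * Q) ∨
      applyWord D (l ++ v) (P * Q * powProd (twoBlockStaircase (a + b) a)) =
        -applyWord D l (P * Q) := by
    rw [applyWord_append]
    rcases H (P * Q) hPQ with h | h <;> rw [h]
    · exact Or.inl rfl
    · rw [applyWord_mul_of_isSymmetric hD hl.1 (fun σ => by simp)]
      exact Or.inr (neg_one_mul _)
  refine or_iff_not_imp_left.mpr fun h0 idx => ?_
  set dP := Finset.univ.sup fun j => MvPolynomial.degreeOf j P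
  set dQ := Finset.univ.sup fun j => MvPolynomial.degreeOf j Q
  have hdP : ∀ j, MvPolynomial.degreeOf j P ≤ dP := fun j =>
    Finset.le_sup (f := fun j => MvPolynomial.degreeOf j P) (Finset.mem_univ j)
  have hdQ : ∀ j, MvPolynomial.degreeOf j Q ≤ dQ := fun j =>
    Finset.le_sup (f := fun j => MvPolynomial.degreeOf j Q) (Finset.mem_univ j)
  have hdeg : ∀ j, MvPolynomial.degreeOf j (P * Q * powProd (twoBlockStaircase (a + b) a)) ≤
      max (dP + (a - 1)) (dQ + (b - 1)) := by
    intro j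
    have h1 := MvPolynomial.degreeOf_mul_le j (P * Q) (powProd (twoBlockStaircase (a + b) a))
    have h2 := MvPolynomial.degreeOf_mul_le j P Q
    rw [degreeOf_powProd] at h1
    have := hdP j
    have := hdQ j
    have := j.isLt
    by_cases hj : j.val < a
    · rw [hQvars j hj] at h2
      simp only [twoBlockStaircase, if_pos hj] at h1
      omega
    · rw [hPvars j (not_lt.mp hj)] at h2
      simp only [twoBlockStaircase, if_neg hj] at h1
      omega
  have hP0 : a = 0 → dP = 0 := fun ha =>
    Nat.le_zero.mp (Finset.sup_le fun j _ => (hPvars j (by omega)).le)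
  have hQ0 : b = 0 → dQ = 0 := fun hb =>
    Nat.le_zero.mp (Finset.sup_le fun j _ => (hQvars j (by omega)).le)
  have hne : applyWord D (l ++ v) (P * Q * powProd (twoBlockStaircase (a + b) a)) ≠ 0 := by
    rcases hw0 with h | h <;> rw [h]
    exacts [h0, neg_ne_zero.mpr h0]
  have hmain := degreeOf_applyWord_add_le hD hw hwlen hdeg hne idx
  have heq : MvPolynomial.degreeOf idx
      (applyWord D (l ++ v) (P * Q * powProd (twoBlockStaircase (a + b) a))) =
      MvPolynomial.degreeOf idx (applyWord D l (P * Q)) := by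
    rcases hw0 with h | h <;> rw [h]
    exact MvPolynomial.degreeOf_neg _ _
  rw [heq] at hmain
  omega
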